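/- (Error estimate with spillback, triangular case.) Let f be a fundamental diagram on the link [a,b], T > 0, η ∈ (0,1), Δ > 0, and S̄ > 0. Let S : [0,T] → {0, S̄} be measurable (the on-and-off effective supply created by spillback from a signalized congested downstream link with triangular fundamental diagram). Let N_ini : [a,b] → ℝ and N_up : [0,T] → ℝ be fixed lower semicontinuous functions, let 𝒞^Δ be the value condition equal to N_ini on {0}×[a,b], to N_up on [0,T]×{a}, to N_down^Δ(s) = ∫₀ˢ S(τ) u_Δ(τ) dτ on [0,T]×{b}, and +∞ elsewhere, and let 𝒞⁰ be the same value condition with downstream part N_down⁰(s) = η ∫₀ˢ S(τ) dτ. Then for all (t,x) ∈ [0,T]×[a,b], |N_{𝒞^Δ}(t,x) − N_{𝒞⁰}(t,x)| ≤ η(1−η) Δ S̄ + S̄ η t. -/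

import Mathlib

open Set

/-- The Δ-periodic on-and-off traffic signal with split η: equal to 1 (green)
during the first ηΔ of each cycle of length Δ, and 0 (red) otherwise. -/
noncomputable def uOnOff (Δ η τ : ℝ) : ℝ :=
  if τ - Δ * (⌊τ / Δ⌋ : ℝ) < η * Δ then 1 else 0

/-- The concave conjugate `f*(u) = sup_{ρ ∈ [0,ρ_j]} (f(ρ) − uρ)` of a fundamental
diagram `f` with jam density `ρ_j`. -/
noncomputable def concConj (f : ℝ → ℝ) (ρj u : ℝ) : ℝ :=
  sSup ((fun ρ => f ρ - u * ρ) '' Set.Icc 0 ρj)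

/-- The generalized Lax-Hopf viability episolution on `[0,T] × [a,b]` associated with a
value condition `𝒞 : [0,T]×[a,b] → ℝ ∪ {+∞}` (encoded as an `EReal`-valued function). -/
noncomputable def laxHopf (fs : ℝ → ℝ) (v w T a b : ℝ) (𝒞 : ℝ → ℝ → EReal)
    (t x : ℝ) : EReal :=
  sInf { z : EReal | ∃ u τ : ℝ, u ∈ Set.Icc (-w) v ∧ 0 ≤ τ ∧
    (t - τ) ∈ Set.Icc 0 T ∧ (x - τ * u) ∈ Set.Icc a b ∧
    z = 𝒞 (t - τ) (x - τ * u) + ((τ * fs u : ℝ) : EReal) }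

/-- The value condition equal to `N_ini(y)` at points `(0,y)`, to `N_up(s)` at points `(s,a)`,
to `N_down(s)` at points `(s,b)`, and `+∞` elsewhere. -/
noncomputable def cornerVC (Nini Nup Ndown : ℝ → ℝ) (a b : ℝ) (s y : ℝ) : EReal :=
  if s = 0 then (Nini y : EReal)
  else if y = a then (Nup s : EReal)
  else if y = b then (Ndown s : EReal)
  else (⊤ : EReal)

theorem uOnOff_nonneg (Δ η τ : ℝ) : 0 ≤ uOnOff Δ η τ := by
  unfold uOnOff; split_ifs <;> norm_num

theorem uOnOff_le_one (Δ η τ : ℝ) : uOnOff Δ η τ ≤ 1 := by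
  unfold uOnOff; split_ifs <;> norm_num

theorem measurable_uOnOff (Δ η : ℝ) : Measurable (uOnOff Δ η) := by
  unfold uOnOff
  refine Measurable.ite (measurableSet_lt ?_ measurable_const) measurable_const measurable_const
  have h : Measurable fun τ : ℝ => (⌊τ / Δ⌋ : ℝ) :=
    (measurable_of_countable (fun n : ℤ => (n : ℝ))).comp
      (Int.measurable_floor.comp (measurable_id.div_const Δ))
  exact measurable_id.sub (h.const_mul Δ)

theorem periodic_uOnOff {Δ : ℝ} (hΔ : 0 < Δ) (η : ℝ) : Function.Periodic (uOnOff Δ η) Δ := by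
  intro τ
  unfold uOnOff
  have h : (τ + Δ) / Δ = τ / Δ + 1 := by field_simp
  rw [h, Int.floor_add_one]
  push_cast
  have h' : τ + Δ - Δ * ((⌊τ / Δ⌋ : ℝ) + 1) = τ - Δ * (⌊τ / Δ⌋ : ℝ) := by ring
  rw [h']

theorem floor_div_eq_zero {Δ τ : ℝ} (hΔ : 0 < Δ) (h0 : 0 ≤ τ) (h1 : τ < Δ) :
    ⌊τ / Δ⌋ = 0 := by
  rw [Int.floor_eq_zero_iff]
  exact ⟨by positivity, by rwa [div_lt_one hΔ]⟩

open MeasureTheory in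
/-- A measurable function that is bounded on `[0,s]` is integrable there. -/
theorem intervalIntegrable_of_measurable_of_bound {g : ℝ → ℝ} (hg : Measurable g) {s C : ℝ}
    (hs : 0 ≤ s) (h : ∀ τ ∈ Icc 0 s, |g τ| ≤ C) : IntervalIntegrable g volume 0 s := by
  rw [intervalIntegrable_iff_integrableOn_Ioc_of_le hs]
  refine Measure.integrableOn_of_bounded (M := C) (by simp) hg.aestronglyMeasurable ?_
  filter_upwards [ae_restrict_mem measurableSet_Ioc] with τ hτ
  exact h τ (Ioc_subset_Icc_self hτ)

open MeasureTheory in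
theorem intervalIntegrable_uOnOff (Δ η : ℝ) (r s : ℝ) :
    IntervalIntegrable (uOnOff Δ η) volume r s := by
  rw [intervalIntegrable_iff]
  refine Measure.integrableOn_of_bounded (M := 1) (by simp)
    (measurable_uOnOff Δ η).aestronglyMeasurable ?_
  filter_upwards with τ
  rw [Real.norm_of_nonneg (uOnOff_nonneg Δ η τ)]
  exact uOnOff_le_one Δ η τ

/-- The cumulative green time within the first cycle. -/
theorem integral_uOnOff_of_mem_Icc {Δ η r : ℝ} (hΔ : 0 < Δ) (hη : η ∈ Ioo (0 : ℝ) 1)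
    (hr : r ∈ Icc 0 Δ) : ∫ τ in (0 : ℝ)..r, uOnOff Δ η τ = min r (η * Δ) := by
  have hηΔ : 0 < η * Δ := mul_pos hη.1 hΔ
  have green : ∀ q, 0 ≤ q → q ≤ r → q ≤ η * Δ → ∫ τ in (0 : ℝ)..q, uOnOff Δ η τ = q := by
    intro q hq hqr hq'
    rw [intervalIntegral.integral_congr_Ioo_of_le (g := fun _ => (1 : ℝ)) hq]
    · simp
    · intro τ hτ
      have hlt : τ < η * Δ := lt_of_lt_of_le hτ.2 hq'
      have := floor_div_eq_zero hΔ hτ.1.le (hτ.2.trans_le (hqr.trans hr.2))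
      simp [uOnOff, this, hlt]
  rcases le_total r (η * Δ) with h | h
  · rw [min_eq_left h, green r hr.1 le_rfl h]
  · rw [min_eq_right h, ← intervalIntegral.integral_add_adjacent_intervals
      (intervalIntegrable_uOnOff Δ η 0 (η * Δ)) (intervalIntegrable_uOnOff Δ η (η * Δ) r),
      green _ hηΔ.le h le_rfl,
      intervalIntegral.integral_congr_Ioo_of_le (g := fun _ => (0 : ℝ)) h]
    · simp
    · intro τ hτ
      have hle : ¬ τ < η * Δ := not_lt.2 hτ.1.le
      have := floor_div_eq_zero hΔ (hηΔ.trans hτ.1).le (hτ.2.trans_le hr.2)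
      simp [uOnOff, this, hle]

/-- The cumulative green time exceeds its average by at most `η(1−η)Δ`. -/
theorem integral_uOnOff_le {Δ η : ℝ} (hΔ : 0 < Δ) (hη : η ∈ Ioo (0 : ℝ) 1) (s : ℝ) :
    ∫ τ in (0 : ℝ)..s, uOnOff Δ η τ ≤ η * s + η * (1 - η) * Δ := by
  have hint : ∀ r, ∫ τ in (0 : ℝ)..r, (uOnOff Δ η τ - η) =
      (∫ τ in (0 : ℝ)..r, uOnOff Δ η τ) - η * r := by
    intro r
    rw [intervalIntegral.integral_sub (intervalIntegrable_uOnOff Δ η 0 r) (by simp)]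
    simp [mul_comm]
  have hper : Function.Periodic (fun τ => uOnOff Δ η τ - η) Δ := by
    intro τ
    simp only [periodic_uOnOff hΔ η τ]
  have key := hper.integral_le_sSup_add_zsmul_of_pos
    ((intervalIntegrable_uOnOff Δ η 0 Δ).sub (by simp)) hΔ s
  have hcycle : ∫ τ in (0 : ℝ)..Δ, (uOnOff Δ η τ - η) = 0 := by
    rw [hint, integral_uOnOff_of_mem_Icc hΔ hη ⟨hΔ.le, le_rfl⟩, min_eq_right, sub_self]
    nlinarith [hη.2]
  rw [hcycle, smul_zero, add_zero, hint] at key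
  have hsup : sSup ((fun r => ∫ τ in (0 : ℝ)..r, (uOnOff Δ η τ - η)) '' Icc 0 Δ) ≤
      η * (1 - η) * Δ := by
    refine csSup_le ((nonempty_Icc.2 hΔ.le).image _) ?_
    rintro _ ⟨r, hr, rfl⟩
    simp only [hint, integral_uOnOff_of_mem_Icc hΔ hη hr]
    have h₁ := mul_le_mul_of_nonneg_left (min_le_left r (η * Δ)) hη.1.le
    have h₂ := mul_le_mul_of_nonneg_left (min_le_right r (η * Δ)) (sub_nonneg.2 hη.2.le)
    linarith
  linarith

/-- The cumulative on-and-off supply and its continuum approximation stay within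
`η(1−η)ΔSbar + Sbar·η·s` of each other. -/
theorem abs_integral_mul_uOnOff_sub_le {Δ η Sbar s : ℝ} (hΔ : 0 < Δ) (hη : η ∈ Ioo (0 : ℝ) 1)
    (hSbar : 0 ≤ Sbar) (hs : 0 ≤ s) {S : ℝ → ℝ} (hSmeas : Measurable S)
    (hS : ∀ τ ∈ Icc 0 s, S τ ∈ Icc 0 Sbar) :
    |(∫ τ in (0 : ℝ)..s, S τ * uOnOff Δ η τ) - η * ∫ τ in (0 : ℝ)..s, S τ| ≤
      η * (1 - η) * Δ * Sbar + Sbar * η * s := by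
  have hη1 : 0 ≤ 1 - η := sub_nonneg.2 hη.2.le
  have hSint := intervalIntegrable_of_measurable_of_bound hSmeas hs (C := Sbar) fun τ hτ => by
    rw [abs_of_nonneg (hS τ hτ).1]
    exact (hS τ hτ).2
  have hSuint := intervalIntegrable_of_measurable_of_bound (g := fun τ => S τ * uOnOff Δ η τ)
    (hSmeas.mul (measurable_uOnOff Δ η)) hs (C := Sbar) fun τ hτ => by
      rw [abs_of_nonneg (mul_nonneg (hS τ hτ).1 (uOnOff_nonneg Δ η τ))]
      exact (mul_le_of_le_one_right (hS τ hτ).1 (uOnOff_le_one Δ η τ)).trans (hS τ hτ).2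
  have hlow : 0 ≤ ∫ τ in (0 : ℝ)..s, S τ * uOnOff Δ η τ :=
    intervalIntegral.integral_nonneg hs fun τ hτ =>
      mul_nonneg (hS τ hτ).1 (uOnOff_nonneg Δ η τ)
  have hSle : ∫ τ in (0 : ℝ)..s, S τ ≤ Sbar * s := by
    refine (intervalIntegral.integral_mono_on hs hSint (g := fun _ => Sbar) (by simp)
      fun τ hτ => (hS τ hτ).2).trans_eq ?_
    simp [mul_comm]
  have hup : (∫ τ in (0 : ℝ)..s, S τ * uOnOff Δ η τ) - η * ∫ τ in (0 : ℝ)..s, S τ ≤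
      Sbar * (1 - η) * ∫ τ in (0 : ℝ)..s, uOnOff Δ η τ := by
    rw [← intervalIntegral.integral_const_mul, ← intervalIntegral.integral_const_mul,
      ← intervalIntegral.integral_sub hSuint (hSint.const_mul η)]
    refine intervalIntegral.integral_mono_on hs (hSuint.sub (hSint.const_mul η))
      ((intervalIntegrable_uOnOff Δ η 0 s).const_mul _) fun τ hτ => ?_
    obtain ⟨h₀, h₁⟩ := hS τ hτ
    unfold uOnOff
    split_ifs
    · nlinarith
    · nlinarith [mul_nonneg hη.1.le h₀]
  have hgreen := mul_le_mul_of_nonneg_left (integral_uOnOff_le hΔ hη s)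
    (mul_nonneg hSbar hη1)
  have hX : 0 ≤ Sbar * η * s := by have := hη.1.le; positivity
  have hY : 0 ≤ η * (1 - η) * Δ * Sbar := by have := hη.1.le; positivity
  rw [abs_le]
  constructor
  · have := mul_le_mul_of_nonneg_left hSle hη.1.le
    linarith
  · have h₁ : Sbar * (1 - η) * (η * s + η * (1 - η) * Δ) =
        (1 - η) * (η * (1 - η) * Δ * Sbar + Sbar * η * s) := by ring
    have h₂ := mul_nonneg hη.1.le (add_nonneg hY hX)
    linarith

/-- Raising the downstream data by at most `ε` up to time `t` raises the value condition by at
most `ε`. -/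
theorem cornerVC_le_add (Nini Nup : ℝ → ℝ) {N M : ℝ → ℝ} {a b ε s : ℝ} (hε : 0 ≤ ε)
    (h : N s ≤ M s + ε) (y : ℝ) :
    cornerVC Nini Nup N a b s y ≤ cornerVC Nini Nup M a b s y + (ε : EReal) := by
  unfold cornerVC
  split_ifs
  · exact_mod_cast le_add_of_nonneg_right hε
  · exact_mod_cast le_add_of_nonneg_right hε
  · exact_mod_cast h
  · simp

/-- The Lax-Hopf episolution at time `t` is monotone, up to a constant, in the value condition
restricted to times in `[0,t]`. -/
theorem laxHopf_le_add (fs : ℝ → ℝ) (v w T a b : ℝ) {𝒞 𝒟 : ℝ → ℝ → EReal} {ε t : ℝ} (x : ℝ)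
    (h : ∀ s ∈ Icc 0 t, ∀ y, 𝒞 s y ≤ 𝒟 s y + (ε : EReal)) :
    laxHopf fs v w T a b 𝒞 t x ≤ laxHopf fs v w T a b 𝒟 t x + (ε : EReal) := by
  rw [← EReal.sub_le_iff_le_add (.inl (EReal.coe_ne_bot ε)) (.inl (EReal.coe_ne_top ε))]
  refine le_sInf ?_
  rintro _ ⟨u, τ, hu, hτ, ht, hx, rfl⟩
  rw [EReal.sub_le_iff_le_add (.inl (EReal.coe_ne_bot ε)) (.inl (EReal.coe_ne_top ε))]
  refine le_trans (sInf_le ⟨u, τ, hu, hτ, ht, hx, rfl⟩) ?_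
  rw [add_right_comm]
  gcongr
  exact h _ ⟨ht.1, by linarith⟩ _

theorem EReal.abs_toReal_sub_le {p q : EReal} {ε : ℝ} (hε : 0 ≤ ε) (hpq : p ≤ q + (ε : EReal))
    (hqp : q ≤ p + (ε : EReal)) : |p.toReal - q.toReal| ≤ ε := by
  induction p with
  | bot =>
    have : q = ⊥ := by simpa using hqp
    simpa [this] using hε
  | top =>
    have : q = ⊤ := by
      induction q with
      | bot => simp at hpq
      | top => rfl
      | coe q => exact absurd (top_le_iff.1 hpq) (by rw [← EReal.coe_add]; exact EReal.coe_ne_top _)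
    simpa [this] using hε
  | coe p =>
    induction q with
    | bot => simp at hpq
    | top => exact absurd (top_le_iff.1 hqp) (by rw [← EReal.coe_add]; exact EReal.coe_ne_top _)
    | coe q =>
      have h₁ : p ≤ q + ε := by exact_mod_cast hpq
      have h₂ : q ≤ p + ε := by exact_mod_cast hqp
      simp only [EReal.toReal_coe]
      rw [abs_le]
      constructor <;> linarith

/-- **Error estimate with spillback, triangular case.** When the effective supply created
by spillback from a congested signalized downstream link (triangular fundamental diagram)
takes only the values `0` and `Sbar`, the solutions of the on-and-off and continuum signal
models differ by at most `η(1−η)ΔSbar + Sbar·η·t`. -/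
theorem laxHopf_onOff_error_spillback_triangular
    -- the fundamental diagram of the link [a,b]
    (ρj : ℝ) (hρj : 0 < ρj) (f : ℝ → ℝ)
    (hfc : ContinuousOn f (Set.Icc 0 ρj)) (hconc : ConcaveOn ℝ (Set.Icc 0 ρj) f)
    (hf0 : f 0 = 0) (hfρj : f ρj = 0)
    -- wave speeds: right derivative of f at 0 and minus the left derivative at ρ_j
    (v w : ℝ) (hv : 0 < v) (hw : 0 < w)
    (hv' : HasDerivWithinAt f v (Set.Ici 0) 0)
    (hw' : HasDerivWithinAt f (-w) (Set.Iic ρj) ρj)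
    -- the domain, signal cycle and split
    (T a b : ℝ) (hT : 0 < T) (hab : a < b)
    (η Δ : ℝ) (hη : η ∈ Set.Ioo (0:ℝ) 1) (hΔ : 0 < Δ)
    -- the on-and-off effective supply taking values in {0, Sbar}
    (Sbar : ℝ) (hSbar : 0 < Sbar) (S : ℝ → ℝ) (hSmeas : Measurable S)
    (hSvals : ∀ τ ∈ Set.Icc (0:ℝ) T, S τ = 0 ∨ S τ = Sbar)
    -- the (lower semicontinuous) initial and upstream data
    (Nini Nup : ℝ → ℝ)
    (hini : LowerSemicontinuousOn Nini (Set.Icc a b))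
    (hup : LowerSemicontinuousOn Nup (Set.Icc 0 T)) :
    ∀ t x, t ∈ Set.Icc 0 T → x ∈ Set.Icc a b →
      |(laxHopf (concConj f ρj) v w T a b
          (cornerVC Nini Nup (fun s => ∫ τ in (0:ℝ)..s, S τ * uOnOff Δ η τ) a b) t x).toReal -
        (laxHopf (concConj f ρj) v w T a b
          (cornerVC Nini Nup (fun s => η * ∫ τ in (0:ℝ)..s, S τ) a b) t x).toReal|
        ≤ η * (1 - η) * Δ * Sbar + Sbar * η * t := by
  intro t x ht hx
  have hε : 0 ≤ η * (1 - η) * Δ * Sbar + Sbar * η * t := by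
    have h₁ := hη.1.le
    have h₂ : 0 ≤ 1 - η := sub_nonneg.2 hη.2.le
    have h₃ := ht.1
    positivity
  have key : ∀ s ∈ Icc 0 t,
      |(∫ τ in (0:ℝ)..s, S τ * uOnOff Δ η τ) - η * ∫ τ in (0:ℝ)..s, S τ| ≤
        η * (1 - η) * Δ * Sbar + Sbar * η * t := by
    intro s hs
    refine (abs_integral_mul_uOnOff_sub_le hΔ hη hSbar.le hs.1 hSmeas ?_).trans ?_
    · intro τ hτ
      rcases hSvals τ ⟨hτ.1, hτ.2.trans (hs.2.trans ht.2)⟩ with h | h <;> rw [h]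
      · exact ⟨le_rfl, hSbar.le⟩
      · exact ⟨hSbar.le, le_rfl⟩
    · have := mul_le_mul_of_nonneg_left hs.2 (mul_nonneg hSbar.le hη.1.le)
      linarith
  refine EReal.abs_toReal_sub_le hε ?_ ?_ <;>
    refine laxHopf_le_add _ _ _ _ _ _ _ fun s hs y => cornerVC_le_add _ _ hε ?_ y <;>
    have := abs_le.1 (key s hs) <;>
    linarith
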